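/- arXiv:1901.08904 — 6 statements merged into one kernel-verified Lean document; each statement's English description precedes it below -/
import Mathlib

section
/- If $D$ is an isotropic subspace of $E$ with $\dim D = k$, then $\dim(D^\perp \cap V_+) = n - k$ and $\dim(D^\perp \cap V_-) = n - k$. -/
/-- The canonical symmetric pairing on `E = T × T*` (with `T* = T →ₗ[ℝ] ℝ` the
dual space): `⟨(u,α),(v,β)⟩ = (α v + β u) / 2`. -/
noncomputable def pairing (T : Type*) [AddCommGroup T] [Module ℝ T] :
    LinearMap.BilinForm ℝ (T × (T →ₗ[ℝ] ℝ)) :=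
  LinearMap.mk₂ ℝ (fun e f => (e.2 f.1 + f.2 e.1) / 2)
    (fun a b c => by simp; ring)
    (fun r a b => by simp [smul_eq_mul]; ring)
    (fun a b c => by simp; ring)
    (fun r a b => by simp [smul_eq_mul]; ring)

/-- `perp S = {e ∈ E | ⟨e, s⟩ = 0 for all s ∈ S}`. -/
noncomputable def perp {T : Type*} [AddCommGroup T] [Module ℝ T]
    (S : Submodule ℝ (T × (T →ₗ[ℝ] ℝ))) :
    Submodule ℝ (T × (T →ₗ[ℝ] ℝ)) where
  carrier := {e | ∀ s ∈ S, pairing T e s = 0}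
  zero_mem' := fun s hs => by simp
  add_mem' := fun {a b} ha hb s hs => by simp [ha s hs, hb s hs]
  smul_mem' := fun r a ha s hs => by simp [ha s hs]

/-- `V₊ = {(u, g(u,·)) : u ∈ T}`, the graph of `g`. -/
noncomputable def Vplus {T : Type*} [AddCommGroup T] [Module ℝ T]
    (g : LinearMap.BilinForm ℝ T) : Submodule ℝ (T × (T →ₗ[ℝ] ℝ)) :=
  LinearMap.range ((LinearMap.id : T →ₗ[ℝ] T).prod g)

/-- `V₋ = {(u, -g(u,·)) : u ∈ T}`, the graph of `-g`. -/
noncomputable def Vminus {T : Type*} [AddCommGroup T] [Module ℝ T]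
    (g : LinearMap.BilinForm ℝ T) : Submodule ℝ (T × (T →ₗ[ℝ] ℝ)) :=
  LinearMap.range ((LinearMap.id : T →ₗ[ℝ] T).prod (-g))

/-- If `h` is symmetric and vanishes on the diagonal only at `0`, then the orthogonal of an
isotropic subspace `D` meets the graph of `h` in dimension `dim T - dim D`. -/
theorem finrank_perp_inf_graph {T : Type*} [AddCommGroup T] [Module ℝ T] [FiniteDimensional ℝ T]
    (h : LinearMap.BilinForm ℝ T) (h_symm : ∀ u v : T, h u v = h v u)
    (h_def : ∀ u : T, h u u = 0 → u = 0)
    (D : Submodule ℝ (T × (T →ₗ[ℝ] ℝ))) (hD : D ≤ perp D) :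
    Module.finrank ℝ (perp D ⊓ LinearMap.range ((LinearMap.id : T →ₗ[ℝ] T).prod h) :
      Submodule ℝ (T × (T →ₗ[ℝ] ℝ))) = Module.finrank ℝ T - Module.finrank ℝ D := by
  let φ : T × (T →ₗ[ℝ] ℝ) →ₗ[ℝ] Module.Dual ℝ T := h.coprod LinearMap.id
  have hφ : ∀ e u, φ e u = h e.1 u + e.2 u := fun e u => by simp [φ]
  have hφ_inj : Function.Injective (φ.domRestrict D) := by
    refine (injective_iff_map_eq_zero _).2 ?_
    rintro ⟨⟨v, β⟩, hd⟩ h0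
    have h1 : ∀ u, h v u + β u = 0 := fun u => by
      rw [← hφ (v, β) u]
      exact LinearMap.congr_fun h0 u
    have h2 : (β v + β v) / 2 = 0 := hD hd _ hd
    obtain rfl : v = 0 := h_def v (by linarith [h1 v])
    obtain rfl : β = 0 := LinearMap.ext fun u => by simpa using h1 u
    rfl
  have h_eq : perp D ⊓ LinearMap.range ((LinearMap.id : T →ₗ[ℝ] T).prod h) =
      (D.map φ).dualCoannihilator.map ((LinearMap.id : T →ₗ[ℝ] T).prod h) := by
    have key : ∀ u, (u, h u) ∈ perp D ↔ u ∈ (D.map φ).dualCoannihilator := fun u => by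
      have h_pair : ∀ e, pairing T (u, h u) e = φ e u / 2 := fun e => by
        rw [hφ, h_symm e.1 u]
        rfl
      rw [Submodule.mem_dualCoannihilator]
      constructor
      · rintro hu _ ⟨e, he, rfl⟩
        have := hu e he
        rw [h_pair] at this
        linarith
      · intro hu e he
        rw [h_pair, hu _ ⟨e, he, rfl⟩, zero_div]
    ext x
    constructor
    · rintro ⟨hx, u, rfl⟩
      exact ⟨u, (key u).1 hx, rfl⟩
    · rintro ⟨u, hu, rfl⟩
      exact ⟨(key u).2 hu, u, rfl⟩
  have h_graph : Function.Injective ((LinearMap.id : T →ₗ[ℝ] T).prod h) :=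
    fun u v huv => congrArg Prod.fst huv
  have h_rank : Module.finrank ℝ (D.map φ) = Module.finrank ℝ D := by
    rw [← LinearMap.range_domRestrict, LinearMap.finrank_range_of_inj hφ_inj]
  rw [h_eq, ← (Submodule.equivMapOfInjective _ h_graph _).finrank_eq, ← h_rank]
  have := Subspace.finrank_add_finrank_dualCoannihilator_eq (D.map φ)
  omega

/-- if `D` is isotropic with `dim D = k`, then
`dim (Dᗮ ∩ V₊) = n - k = dim (Dᗮ ∩ V₋)`. -/
theorem stmt4 {T : Type*} [AddCommGroup T] [Module ℝ T] [FiniteDimensional ℝ T]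
    (g : LinearMap.BilinForm ℝ T)
    (hg_symm : ∀ u v : T, g u v = g v u)
    (hg_pos : ∀ u : T, u ≠ 0 → 0 < g u u)
    (D : Submodule ℝ (T × (T →ₗ[ℝ] ℝ)))
    (hD_iso : D ≤ perp D)
    (k : ℕ) (hk : Module.finrank ℝ D = k) :
    Module.finrank ℝ (perp D ⊓ Vplus g : Submodule ℝ (T × (T →ₗ[ℝ] ℝ))) =
      Module.finrank ℝ T - k ∧
    Module.finrank ℝ (perp D ⊓ Vminus g : Submodule ℝ (T × (T →ₗ[ℝ] ℝ))) =
      Module.finrank ℝ T - k := by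
  subst hk
  have h_def : ∀ u : T, g u u = 0 → u = 0 := fun u hu =>
    by_contra fun hne => (hg_pos u hne).ne' hu
  exact ⟨finrank_perp_inf_graph g hg_symm h_def D hD_iso,
    finrank_perp_inf_graph (-g) (fun u v => congrArg Neg.neg (hg_symm u v))
      (fun u hu => h_def u (neg_eq_zero.1 hu)) D hD_iso⟩
end

section
/- The sum $V_D := D + (D^\perp \cap V_+)$ is direct, i.e. $D \cap (D^\perp \cap V_+) = \{0\}$, and $\dim V_D = n$. -/
theorem pairing_apply {T : Type*} [AddCommGroup T] [Module ℝ T] (e f : T × (T →ₗ[ℝ] ℝ)) :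
    pairing T e f = (e.2 f.1 + f.2 e.1) / 2 := rfl

/-- An element of an isotropic subspace is null. -/
theorem snd_apply_fst_eq_zero_of_isotropic {T : Type*} [AddCommGroup T] [Module ℝ T]
    {D : Submodule ℝ (T × (T →ₗ[ℝ] ℝ))} (hD : D ≤ perp D) {d : T × (T →ₗ[ℝ] ℝ)} (hd : d ∈ D) :
    d.2 d.1 = 0 := by
  have h : pairing T d d = 0 := hD hd d hd
  rw [pairing_apply] at h
  linarith

/-- `Dᗮ ∩ V₊` is the graph of `g` over the common kernel of the functionals `g v + β`,
`(v, β) ∈ D`. -/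
theorem perp_inf_Vplus_eq_map {T : Type*} [AddCommGroup T] [Module ℝ T]
    (g : LinearMap.BilinForm ℝ T) (hg_symm : ∀ u v : T, g u v = g v u)
    (D : Submodule ℝ (T × (T →ₗ[ℝ] ℝ))) :
    perp D ⊓ Vplus g =
      (Submodule.dualCoannihilator (D.map (g.coprod LinearMap.id))).map
        ((LinearMap.id : T →ₗ[ℝ] T).prod g) := by
  have key (u : T) : ((LinearMap.id : T →ₗ[ℝ] T).prod g) u ∈ perp D ↔
      u ∈ Submodule.dualCoannihilator (D.map (g.coprod LinearMap.id)) := by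
    rw [Submodule.mem_dualCoannihilator]
    constructor
    · rintro h _ ⟨d, hd, rfl⟩
      have h' : (g u d.1 + d.2 u) / 2 = 0 := h d hd
      change g d.1 u + d.2 u = 0
      rw [hg_symm]
      linarith
    · intro h d hd
      have h' : g d.1 u + d.2 u = 0 := h _ ⟨d, hd, rfl⟩
      change (g u d.1 + d.2 u) / 2 = 0
      rw [hg_symm, h', zero_div]
  ext e
  constructor
  · rintro ⟨he, u, rfl⟩
    exact ⟨u, (key u).1 he, rfl⟩
  · rintro ⟨u, hu, rfl⟩
    exact ⟨(key u).2 hu, u, rfl⟩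

/-- the sum `V_D = D + (Dᗮ ∩ V₊)` is direct and `dim V_D = n`. -/
theorem stmt5 {T : Type*} [AddCommGroup T] [Module ℝ T] [FiniteDimensional ℝ T]
    (g : LinearMap.BilinForm ℝ T)
    (hg_symm : ∀ u v : T, g u v = g v u)
    (hg_pos : ∀ u : T, u ≠ 0 → 0 < g u u)
    (D : Submodule ℝ (T × (T →ₗ[ℝ] ℝ)))
    (hD_iso : D ≤ perp D) :
    D ⊓ (perp D ⊓ Vplus g) = ⊥ ∧
    Module.finrank ℝ (D ⊔ (perp D ⊓ Vplus g) : Submodule ℝ (T × (T →ₗ[ℝ] ℝ))) =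
      Module.finrank ℝ T := by
  have pos {u : T} (h : g u u = 0) : u = 0 := by
    by_contra hu
    exact (hg_pos u hu).ne' h
  have hdisj : D ⊓ (perp D ⊓ Vplus g) = ⊥ := by
    rw [eq_bot_iff]
    rintro _ ⟨hd, -, u, rfl⟩
    have hu : u = 0 := pos (snd_apply_fst_eq_zero_of_isotropic hD_iso hd)
    simp [hu]
  refine ⟨hdisj, ?_⟩
  have hinj : Function.Injective ((g.coprod LinearMap.id).domRestrict D) := by
    rw [injective_iff_map_eq_zero]
    rintro ⟨⟨v, β⟩, hd⟩ h
    have h' : g v + β = 0 := h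
    have hβ : β v = 0 := snd_apply_fst_eq_zero_of_isotropic hD_iso hd
    have hv : v = 0 := pos (by simpa [hβ] using LinearMap.congr_fun h' v)
    subst hv
    simpa using h'
  have hgraph : Function.Injective ((LinearMap.id : T →ₗ[ℝ] T).prod g) :=
    fun _ _ h => congrArg Prod.fst h
  have hmap : Module.finrank ℝ (D.map (g.coprod LinearMap.id)) = Module.finrank ℝ D := by
    rw [← LinearMap.range_domRestrict, LinearMap.finrank_range_of_inj hinj]
  have hsum := Submodule.finrank_sup_add_finrank_inf_eq D (perp D ⊓ Vplus g)
  have hco := Subspace.finrank_add_finrank_dualCoannihilator_eq (D.map (g.coprod LinearMap.id))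
  rw [hdisj, finrank_bot, add_zero] at hsum
  rw [hsum, perp_inf_Vplus_eq_map g hg_symm D,
    ← (Submodule.equivMapOfInjective _ hgraph _).finrank_eq,
    ← hmap, hco]
end

section
/- With $V_D := D + (D^\perp \cap V_+)$, the orthogonal complement of $V_D$ with respect to the pairing is $V_D^\perp = D + (D^\perp \cap V_-)$, and this latter sum is direct. -/
theorem pairing_comm {T : Type*} [AddCommGroup T] [Module ℝ T] (e f : T × (T →ₗ[ℝ] ℝ)) :
    pairing T e f = pairing T f e := by
  rw [pairing_apply, pairing_apply, add_comm]

theorem pairing_isRefl (T : Type*) [AddCommGroup T] [Module ℝ T] : (pairing T).IsRefl :=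
  fun e f h => (pairing_comm f e).trans h

theorem eq_zero_of_pairing_eq_zero {T : Type*} [AddCommGroup T] [Module ℝ T]
    (e : T × (T →ₗ[ℝ] ℝ)) (h : ∀ f, pairing T e f = 0) : e = 0 := by
  refine Prod.ext ?_ (LinearMap.ext fun v => ?_)
  · refine (Module.forall_dual_apply_eq_zero_iff ℝ e.1).mp fun β => ?_
    simpa [pairing_apply] using h (0, β)
  · simpa [pairing_apply] using h (v, 0)

theorem pairing_nondegenerate (T : Type*) [AddCommGroup T] [Module ℝ T] :
    (pairing T).Nondegenerate :=
  ⟨eq_zero_of_pairing_eq_zero,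
    fun e h => eq_zero_of_pairing_eq_zero e fun f => (pairing_comm e f).trans (h f)⟩

theorem mem_perp {T : Type*} [AddCommGroup T] [Module ℝ T]
    {S : Submodule ℝ (T × (T →ₗ[ℝ] ℝ))} {e : T × (T →ₗ[ℝ] ℝ)} :
    e ∈ perp S ↔ ∀ s ∈ S, pairing T e s = 0 :=
  Iff.rfl

theorem perp_eq_orthogonal {T : Type*} [AddCommGroup T] [Module ℝ T]
    (S : Submodule ℝ (T × (T →ₗ[ℝ] ℝ))) : perp S = (pairing T).orthogonal S := by
  ext e
  exact forall₂_congr fun s _ => by rw [pairing_comm]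

theorem perp_perp {T : Type*} [AddCommGroup T] [Module ℝ T] [FiniteDimensional ℝ T]
    (S : Submodule ℝ (T × (T →ₗ[ℝ] ℝ))) : perp (perp S) = S := by
  rw [perp_eq_orthogonal, perp_eq_orthogonal]
  exact LinearMap.BilinForm.orthogonal_orthogonal (pairing_nondegenerate T) (pairing_isRefl T) S

theorem perp_sup {T : Type*} [AddCommGroup T] [Module ℝ T]
    (A B : Submodule ℝ (T × (T →ₗ[ℝ] ℝ))) : perp (A ⊔ B) = perp A ⊓ perp B := by
  ext e
  refine ⟨fun h => ⟨fun s hs => h s (Submodule.mem_sup_left hs),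
    fun s hs => h s (Submodule.mem_sup_right hs)⟩, fun h s hs => ?_⟩
  obtain ⟨a, ha, b, hb, rfl⟩ := Submodule.mem_sup.mp hs
  rw [map_add, h.1 a ha, h.2 b hb, add_zero]

theorem mem_Vplus {T : Type*} [AddCommGroup T] [Module ℝ T] {g : LinearMap.BilinForm ℝ T}
    {e : T × (T →ₗ[ℝ] ℝ)} : e ∈ Vplus g ↔ e.2 = g e.1 := by
  constructor
  · rintro ⟨u, rfl⟩
    rfl
  · exact fun h => ⟨e.1, Prod.ext rfl h.symm⟩

theorem mem_Vminus {T : Type*} [AddCommGroup T] [Module ℝ T] {g : LinearMap.BilinForm ℝ T}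
    {e : T × (T →ₗ[ℝ] ℝ)} : e ∈ Vminus g ↔ e.2 = -g e.1 := by
  constructor
  · rintro ⟨u, rfl⟩
    rfl
  · exact fun h => ⟨e.1, Prod.ext rfl h.symm⟩

theorem perp_Vminus {T : Type*} [AddCommGroup T] [Module ℝ T] {g : LinearMap.BilinForm ℝ T}
    (hg_symm : ∀ u v : T, g u v = g v u) : perp (Vminus g) = Vplus g := by
  ext e
  rw [mem_perp, mem_Vplus]
  constructor
  · intro h
    ext v
    have hv := h (v, -g v) (mem_Vminus.mpr rfl)
    simp only [pairing_apply, LinearMap.neg_apply] at hv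
    linarith [hg_symm v e.1]
  · intro h s hs
    rw [pairing_apply, h, mem_Vminus.mp hs, LinearMap.neg_apply, hg_symm s.1 e.1]
    ring

/-- with `V_D = D + (Dᗮ ∩ V₊)` one has
`V_Dᗮ = D + (Dᗮ ∩ V₋)`, with the latter sum direct. -/
theorem stmt7 {T : Type*} [AddCommGroup T] [Module ℝ T] [FiniteDimensional ℝ T]
    (g : LinearMap.BilinForm ℝ T)
    (hg_symm : ∀ u v : T, g u v = g v u)
    (hg_pos : ∀ u : T, u ≠ 0 → 0 < g u u)
    (D : Submodule ℝ (T × (T →ₗ[ℝ] ℝ)))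
    (hD_iso : D ≤ perp D) :
    perp (D ⊔ (perp D ⊓ Vplus g)) = D ⊔ (perp D ⊓ Vminus g) ∧
    D ⊓ (perp D ⊓ Vminus g) = ⊥ := by
  constructor
  · have hperp : perp (perp D ⊓ Vplus g) = D ⊔ Vminus g := by
      rw [← perp_Vminus hg_symm, ← perp_sup, perp_perp]
    rw [perp_sup, hperp, inf_comm, sup_inf_assoc_of_le _ hD_iso, inf_comm]
  · refine (Submodule.eq_bot_iff _).mpr fun e he => ?_
    obtain ⟨heD, -, heV⟩ := he
    have h2 : e.2 = -g e.1 := mem_Vminus.mp heV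
    have h0 : pairing T e e = 0 := hD_iso heD e heD
    have h1 : e.1 = 0 := by
      by_contra hne
      rw [pairing_apply, h2, LinearMap.neg_apply] at h0
      linarith [hg_pos e.1 hne]
    exact Prod.ext h1 (by rw [h2, h1, map_zero, neg_zero]; rfl)
end

section
/- Every positive definite subspace $V \subseteq E$ with $\dim V = n$ satisfies $V \cap (\{0\} \times T^*) = \{0\}$ and is the graph of a unique linear map $A : T \to T^*$, i.e. $V = \{(u, A(u)) : u \in T\}$; moreover the symmetric bilinear form $h(u,v) := \tfrac{1}{2}\big((A u)(v) + (A v)(u)\big)$ on $T$ is positive definite. -/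
theorem pairing_self {T : Type*} [AddCommGroup T] [Module ℝ T] (e : T × (T →ₗ[ℝ] ℝ)) :
    pairing T e e = (e.2 e.1 + e.2 e.1) / 2 := rfl

theorem fst_ne_zero_of_pairing_pos {T : Type*} [AddCommGroup T] [Module ℝ T]
    {V : Submodule ℝ (T × (T →ₗ[ℝ] ℝ))} (hV : ∀ e ∈ V, e ≠ 0 → 0 < pairing T e e)
    {e : T × (T →ₗ[ℝ] ℝ)} (he : e ∈ V) (he0 : e ≠ 0) : e.1 ≠ 0 := by
  intro h
  have := hV e he he0
  simp [pairing_self, h] at this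

/-- every positive definite subspace `V ⊆ E` of dimension `n`
meets `{0} × T*` trivially, is the graph of a unique linear map `A : T → T*`,
and the symmetric form `h(u,v) = ((A u)(v) + (A v)(u))/2` is positive definite. -/
theorem stmt8 {T : Type*} [AddCommGroup T] [Module ℝ T] [FiniteDimensional ℝ T]
    (V : Submodule ℝ (T × (T →ₗ[ℝ] ℝ)))
    (hV_pos : ∀ e ∈ V, e ≠ 0 → 0 < pairing T e e)
    (hV_dim : Module.finrank ℝ V = Module.finrank ℝ T) :
    V ⊓ Submodule.prod (⊥ : Submodule ℝ T) (⊤ : Submodule ℝ ((T →ₗ[ℝ] ℝ))) = ⊥ ∧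
    ∃! A : T →ₗ[ℝ] (T →ₗ[ℝ] ℝ),
      (V : Set (T × (T →ₗ[ℝ] ℝ))) = {p | ∃ u : T, p = (u, A u)} ∧
      ∀ u : T, u ≠ 0 → 0 < ((A u) u + (A u) u) / 2 := by
  have hfst : ∀ e ∈ V, e.1 = 0 → e = 0 := fun e he h => by
    by_contra h0
    exact fst_ne_zero_of_pairing_pos hV_pos he h0 h
  refine ⟨(Submodule.eq_bot_iff _).2 fun e he => hfst e he.1 he.2.1, ?_⟩
  have hinj : Function.Injective ((LinearMap.fst ℝ T (T →ₗ[ℝ] ℝ)).domRestrict V) := by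
    rw [injective_iff_map_eq_zero]
    exact fun e he => Subtype.ext (hfst e e.2 he)
  let φ := LinearMap.linearEquivOfInjective (K := ℝ) (V := V) (V₂ := T)
    ((LinearMap.fst ℝ T (T →ₗ[ℝ] ℝ)).domRestrict V) hinj hV_dim
  have hφ : ∀ e : V, φ e = (e : T × (T →ₗ[ℝ] ℝ)).1 := fun _ => rfl
  let A : T →ₗ[ℝ] (T →ₗ[ℝ] ℝ) :=
    LinearMap.snd ℝ T (T →ₗ[ℝ] ℝ) ∘ₗ V.subtype ∘ₗ φ.symm.toLinearMap
  have hA : ∀ u, ((φ.symm u : V) : T × (T →ₗ[ℝ] ℝ)) = (u, A u) := fun u =>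
    Prod.ext ((hφ _).symm.trans (φ.apply_symm_apply u)) rfl
  have hmem : ∀ u, (u, A u) ∈ V := fun u => hA u ▸ (φ.symm u).2
  refine ⟨A, ⟨?_, fun u hu => ?_⟩, ?_⟩
  · ext p
    constructor
    · intro hp
      exact ⟨p.1, by rw [← hA, ← hφ ⟨p, hp⟩, φ.symm_apply_apply]⟩
    · rintro ⟨u, rfl⟩
      exact hmem u
  · exact hV_pos _ (hmem u) fun h => hu (congrArg Prod.fst h)
  · rintro B ⟨hB, -⟩
    ext1 u
    obtain ⟨v, hv⟩ : (u, A u) ∈ {p | ∃ u : T, p = (u, B u)} := hB ▸ hmem u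
    obtain ⟨rfl, h⟩ := Prod.mk.inj hv
    exact LinearMap.congr_fun h.symm
end

section
/- Let $D \subseteq E$ be an isotropic subspace that is projectable, i.e. the projection $E \to T$ onto the first factor is injective on $D$, and let $W$ be a pre-$D$-transverse generalized metric. Then $W \cap (\{0\} \times T^*) = \{0\}$, so $W$ is the graph of a unique linear map $A : T \to T^*$; moreover the symmetric bilinear form $h(u,v) := \tfrac{1}{2}\big((A u)(v) + (A v)(u)\big)$ on $T$ is positive semidefinite and its kernel $\{u \in T : h(u,\cdot) = 0\}$ equals the image of $D$ under the projection $E \to T$. -/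
/-- A subspace of `M × N` of dimension `dim M` on which the first projection is injective
is the graph of a linear map. -/
theorem Submodule.exists_eq_graph_of_finrank_eq {K M N : Type*} [Field K] [AddCommGroup M]
    [Module K M] [AddCommGroup N] [Module K N] [FiniteDimensional K M] [FiniteDimensional K N]
    (W : Submodule K (M × N)) (hdim : Module.finrank K W = Module.finrank K M)
    (hW : ∀ w ∈ W, w.1 = 0 → w = 0) : ∃ A : M →ₗ[K] N, W = A.graph := by
  have hinj : Function.Injective (LinearMap.fst K M N ∘ₗ W.subtype) := by
    rw [injective_iff_map_eq_zero]
    rintro ⟨w, hw⟩ h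
    exact Subtype.ext (hW w hw h)
  exact Submodule.exists_eq_graph
    ⟨hinj, (LinearMap.injective_iff_surjective_of_finrank_eq_finrank hdim).1 hinj⟩

/-- for a projectable isotropic `D` and a pre-`D`-transverse
generalized metric `W`, the subspace `W` meets `{0} × T*` trivially, hence is
the graph of a unique linear map `A : T → T*`; the symmetric form
`h(u,v) = ((A u)(v) + (A v)(u))/2` is positive semidefinite and its kernel is
the image of `D` under the projection `E → T`. -/
theorem stmt13 {T : Type*} [AddCommGroup T] [Module ℝ T] [FiniteDimensional ℝ T]
    (D : Submodule ℝ (T × (T →ₗ[ℝ] ℝ)))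
    (hD_iso : D ≤ perp D)
    (hD_proj : Set.InjOn Prod.fst (D : Set (T × (T →ₗ[ℝ] ℝ))))
    (W : Submodule ℝ (T × (T →ₗ[ℝ] ℝ)))
    (hW_dim : Module.finrank ℝ W = Module.finrank ℝ T)
    (hDW : D ≤ W) (hWD : W ≤ perp D)
    (hW_pos : ∀ w ∈ W, w ∉ D → 0 < pairing T w w) :
    W ⊓ Submodule.prod (⊥ : Submodule ℝ T) (⊤ : Submodule ℝ ((T →ₗ[ℝ] ℝ))) = ⊥ ∧
    ∃! A : T →ₗ[ℝ] (T →ₗ[ℝ] ℝ),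
      (W : Set (T × (T →ₗ[ℝ] ℝ))) = {p | ∃ u : T, p = (u, A u)} ∧
      (∀ u : T, 0 ≤ ((A u) u + (A u) u) / 2) ∧
      {u : T | ∀ v : T, ((A u) v + (A v) u) / 2 = 0} =
        Prod.fst '' (D : Set (T × (T →ₗ[ℝ] ℝ))) := by
  have hcot : ∀ w ∈ W, w.1 = 0 → w = 0 := by
    intro w hw h
    have hwD : w ∈ D := by
      by_contra hn
      have hpos := hW_pos w hw hn
      simp [pairing_apply, h] at hpos
    exact hD_proj hwD D.zero_mem h
  have hgraph : ∀ A : T →ₗ[ℝ] (T →ₗ[ℝ] ℝ),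
      (A.graph : Set (T × (T →ₗ[ℝ] ℝ))) = {p | ∃ u : T, p = (u, A u)} := by
    intro A
    ext ⟨u, α⟩
    simp [LinearMap.mem_graph_iff]
  refine ⟨?_, ?_⟩
  · rw [Submodule.eq_bot_iff]
    rintro w ⟨hw, h, -⟩
    exact hcot w hw h
  obtain ⟨A, rfl⟩ := W.exists_eq_graph_of_finrank_eq hW_dim hcot
  have hmem : ∀ u, (u, A u) ∈ A.graph := fun u => (A.mem_graph_iff _).2 rfl
  have hpos : ∀ u, (u, A u) ∉ D → 0 < (A u u + A u u) / 2 := fun u hu =>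
    hW_pos _ (hmem u) hu
  refine ⟨A, ⟨hgraph A, fun u => ?_, ?_⟩, ?_⟩
  · by_cases hu : (u, A u) ∈ D
    · exact (hD_iso hu _ hu).ge
    · exact (hpos u hu).le
  · ext u
    constructor
    · intro hu
      refine ⟨(u, A u), ?_, rfl⟩
      by_contra hn
      exact (hpos u hn).ne' (hu u)
    · rintro ⟨⟨u, α⟩, hd, rfl⟩ v
      obtain rfl : α = A u := (A.mem_graph_iff _).1 (hDW hd)
      have h : (A v u + A u v) / 2 = 0 := hWD (hmem v) _ hd
      rwa [add_comm] at h
  · rintro B ⟨hB, -, -⟩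
    refine LinearMap.ext fun u => ?_
    have hu : (u, B u) ∈ (A.graph : Set (T × (T →ₗ[ℝ] ℝ))) := hB ▸ ⟨u, rfl⟩
    exact (A.mem_graph_iff _).1 hu
end

section
/- Let $K \subseteq T$ be a subspace, let $P : T \to T$ be the $g$-orthogonal projection onto the $g$-orthogonal complement of $K$, define the positive semidefinite symmetric bilinear form $h(u,v) := g(Pu, Pv)$ on $T$, and set $D := K \times \{0\} \subseteq E$. Then the graph of $h$, namely $\{(u, h(u,\cdot)) : u \in T\}$, equals $D + (D^\perp \cap V_+)$, where $V_+$ is the graph of $g$. -/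
/-- for a subspace `K ⊆ T`, the `g`-orthogonal projection `P`
onto the `g`-orthogonal complement of `K`, the form `h(u,v) = g(Pu, Pv)` and
`D = K × {0}`, the graph of `h` equals `D + (Dᗮ ∩ V₊)`. -/
theorem stmt14 {T : Type*} [AddCommGroup T] [Module ℝ T] [FiniteDimensional ℝ T]
    (g : LinearMap.BilinForm ℝ T)
    (hg_symm : ∀ u v : T, g u v = g v u)
    (hg_pos : ∀ u : T, u ≠ 0 → 0 < g u u)
    (K : Submodule ℝ T)
    (P : T →ₗ[ℝ] T)
    (hP_perp : ∀ u : T, ∀ k ∈ K, g (P u) k = 0)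
    (hP_proj : ∀ u : T, u - P u ∈ K) :
    {p : T × (T →ₗ[ℝ] ℝ) | ∃ u : T, p = (u, (g (P u)) ∘ₗ P)} =
      ((Submodule.prod K (⊥ : Submodule ℝ ((T →ₗ[ℝ] ℝ))) ⊔
        (perp (Submodule.prod K ⊥) ⊓ Vplus g) :
          Submodule ℝ (T × (T →ₗ[ℝ] ℝ))) : Set (T × (T →ₗ[ℝ] ℝ))) := by
  have pairing_apply : ∀ e f : T × (T →ₗ[ℝ] ℝ), pairing T e f = (e.2 f.1 + f.2 e.1) / 2 :=
    fun _ _ => rfl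
  have comp_P : ∀ u : T, (g (P u)) ∘ₗ P = g (P u) := fun u => by
    ext v
    have h := hP_perp u _ (hP_proj v)
    rw [map_sub, sub_eq_zero] at h
    exact h.symm
  ext p
  simp only [Set.mem_ofPred_eq, SetLike.mem_coe, Submodule.mem_sup]
  constructor
  · rintro ⟨u, rfl⟩
    refine ⟨(u - P u, 0), ⟨hP_proj u, rfl⟩, (P u, g (P u)), ⟨?_, P u, rfl⟩, ?_⟩
    · rintro ⟨k, β⟩ ⟨hk, hβ⟩
      obtain rfl : β = 0 := hβ
      simp [pairing_apply, hP_perp u k hk]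
    · simp [comp_P]
  · rintro ⟨⟨k, β⟩, ⟨hk, hβ⟩, _, ⟨hw, w, rfl⟩, rfl⟩
    obtain rfl : β = 0 := hβ
    have w_perp : ∀ k' ∈ K, g w k' = 0 := fun k' hk' => by
      have h := hw (k', 0) ⟨hk', rfl⟩
      simpa [pairing_apply] using h
    have sub_mem : w - P (k + w) ∈ K := by
      have h := K.sub_mem (hP_proj (k + w)) hk
      rwa [show k + w - P (k + w) - k = w - P (k + w) by abel] at h
    have P_eq : P (k + w) = w := by
      by_contra hne
      have h := hg_pos (w - P (k + w)) (sub_ne_zero.mpr (Ne.symm hne))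
      have h' : g (w - P (k + w)) (w - P (k + w)) = 0 := by
        rw [map_sub g, LinearMap.sub_apply, w_perp _ sub_mem, hP_perp _ _ sub_mem, sub_zero]
      exact h.ne' h'
    refine ⟨k + w, ?_⟩
    rw [comp_P, P_eq]
    simp
end
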